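/- Let n ≥ 2, 1 ≤ τ ≤ n, let f_i : ℝ^d → ℝ be convex, differentiable and L_i-smooth, and set f = (1/n) Σ_{i=1}^n f_i. Let S be the τ-nice sampling (uniform over all subsets of [n] of cardinality τ). Then for all x, y ∈ ℝ^d: E_S ‖(1/n) Σ_{i∈S} (n/τ)(∇f_i(x) − ∇f_i(y)) − (∇f(x) − ∇f(y))‖² ≤ 2 · ((n−τ)/(τ(n−1))) · max_{i∈[n]} L_i · (f(x) − f(y) − ⟨∇f(y), x − y⟩). -/

import Mathlib

open scoped RealInnerProductSpace BigOperators

section helpers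

variable {E : Type*} [NormedAddCommGroup E] [InnerProductSpace ℝ E] [CompleteSpace E]

theorem aux_line {f : E → ℝ} {f' : E → E} (hg : ∀ x, HasGradientAt f (f' x) x) (x y : E) (t : ℝ) :
    HasDerivAt (fun t : ℝ => f (y + t • (x - y))) ⟪f' (y + t • (x - y)), x - y⟫ t := by
  have h1 : HasDerivAt (fun t : ℝ => y + t • (x - y)) (x - y) t := by
    simpa using ((hasDerivAt_id t).smul_const (x - y)).const_add y
  have h2 := (hg (y + t • (x - y))).hasFDerivAt
  have h3 := h2.comp_hasDerivAt t h1
  simp only [InnerProductSpace.toDual_apply_apply] at h3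
  exact h3

theorem aux_convex {f : E → ℝ} {f' : E → E} (hg : ∀ x, HasGradientAt f (f' x) x)
    (hc : ConvexOn ℝ Set.univ f) (x y : E) : f y + ⟪f' y, x - y⟫ ≤ f x := by
  have h0 := aux_line hg x y 0
  have hc' : ConvexOn ℝ Set.univ (fun t : ℝ => f (y + t • (x - y))) := by
    have := hc.comp_affineMap (AffineMap.lineMap y x : ℝ →ᵃ[ℝ] E)
    have e : (fun t : ℝ => f (y + t • (x - y))) = f ∘ (AffineMap.lineMap y x : ℝ →ᵃ[ℝ] E) := by
      funext t
      simp [AffineMap.lineMap_apply, add_comm]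
    rw [e]
    exact this
  have := hc'.le_slope_of_hasDerivAt (Set.mem_univ 0) (Set.mem_univ 1) one_pos h0
  simp [slope_def_field] at this
  linarith

theorem aux_descent {f : E → ℝ} {f' : E → E} (hg : ∀ x, HasGradientAt f (f' x) x)
    {L : ℝ} (hs : ∀ x y, ‖f' x - f' y‖ ≤ L * ‖x - y‖) (x y : E) :
    f x ≤ f y + ⟪f' y, x - y⟫ + L / 2 * ‖x - y‖ ^ 2 := by
  have hd : ∀ t : ℝ, HasDerivAt
      (fun t : ℝ => f (y + t • (x - y)) - t * ⟪f' y, x - y⟫ - t ^ 2 * (L / 2 * ‖x - y‖ ^ 2))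
      (⟪f' (y + t • (x - y)), x - y⟫ - ⟪f' y, x - y⟫ - 2 * t * (L / 2 * ‖x - y‖ ^ 2)) t := by
    intro t
    have h1 := (hasDerivAt_id t).mul_const ⟪f' y, x - y⟫
    have h2 := (hasDerivAt_pow 2 t).mul_const (L / 2 * ‖x - y‖ ^ 2)
    have := ((aux_line hg x y t).sub h1).sub h2
    refine HasDerivAt.congr_deriv this ?_
    simp
  have hanti := antitoneOn_of_hasDerivWithinAt_nonpos (convex_Icc (0 : ℝ) 1)
    (fun t _ => (hd t).continuousAt.continuousWithinAt)
    (fun t _ => (hd t).hasDerivWithinAt) (by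
      intro t ht
      rw [interior_Icc] at ht
      rw [← inner_sub_left]
      have h1 := real_inner_le_norm (f' (y + t • (x - y)) - f' y) (x - y)
      have h2 := hs (y + t • (x - y)) y
      rw [add_sub_cancel_left, norm_smul, Real.norm_of_nonneg ht.1.le] at h2
      have h3 := mul_le_mul_of_nonneg_right h2 (norm_nonneg (x - y))
      nlinarith)
  have := hanti (Set.left_mem_Icc.2 zero_le_one) (Set.right_mem_Icc.2 zero_le_one) zero_le_one
  simp at this
  linarith

theorem aux_coco {f : E → ℝ} {f' : E → E} (hg : ∀ x, HasGradientAt f (f' x) x)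
    (hc : ConvexOn ℝ Set.univ f)
    {L : ℝ} (hL : 0 ≤ L) (hs : ∀ x y, ‖f' x - f' y‖ ≤ L * ‖x - y‖) (x y : E) :
    ‖f' x - f' y‖ ^ 2 ≤ 2 * L * (f x - f y - ⟪f' y, x - y⟫) := by
  rcases hL.eq_or_lt with rfl | hL
  · have := hs x y
    simp only [zero_mul] at this
    have h0 : ‖f' x - f' y‖ = 0 := le_antisymm this (norm_nonneg _)
    simp [h0]
  · have h1 := aux_convex hg hc (x - L⁻¹ • (f' x - f' y)) y
    have h2 := aux_descent hg hs (x - L⁻¹ • (f' x - f' y)) x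
    have e1 : x - L⁻¹ • (f' x - f' y) - x = - (L⁻¹ • (f' x - f' y)) := by abel
    have e2 : x - L⁻¹ • (f' x - f' y) - y = (x - y) - (L⁻¹ • (f' x - f' y)) := by abel
    rw [e1, norm_neg, norm_smul, Real.norm_of_nonneg (inv_nonneg.2 hL.le), inner_neg_right,
      real_inner_smul_right] at h2
    rw [e2, inner_sub_right, real_inner_smul_right] at h1
    have h3 : ⟪f' x, f' x - f' y⟫ - ⟪f' y, f' x - f' y⟫ = ‖f' x - f' y‖ ^ 2 := by
      rw [← inner_sub_left, real_inner_self_eq_norm_sq]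
    have h4 : L / 2 * (L⁻¹ * ‖f' x - f' y‖) ^ 2 = L⁻¹ / 2 * ‖f' x - f' y‖ ^ 2 := by
      field_simp
    rw [h4] at h2
    have h5 : L⁻¹ / 2 * ‖f' x - f' y‖ ^ 2 ≤ f x - f y - ⟪f' y, x - y⟫ := by
      rw [← h3] at h2 ⊢
      linarith
    have h6 := mul_le_mul_of_nonneg_left h5 (by positivity : 0 ≤ 2 * L)
    have h7 : 2 * L * (L⁻¹ / 2 * ‖f' x - f' y‖ ^ 2) = ‖f' x - f' y‖ ^ 2 := by field_simp
    linarith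

theorem aux_count1 {n τ : ℕ} (hτ1 : 1 ≤ τ) (i : Fin n) :
    (n : ℝ) * (((Finset.univ.powersetCard τ).filter (fun C : Finset (Fin n) => i ∈ C)).card : ℝ)
      = τ * n.choose τ := by
  have := Finset.card_filter_powersetCard_subset {i} Finset.univ τ (Finset.subset_univ _) (by simpa)
  simp only [Finset.singleton_subset_iff, Finset.card_univ, Fintype.card_fin,
    Finset.card_singleton] at this
  rw [this]
  obtain ⟨k, rfl⟩ : ∃ k, τ = k + 1 := ⟨τ - 1, by omega⟩
  obtain ⟨m, rfl⟩ : ∃ m, n = m + 1 := ⟨n - 1, by have := i.2; omega⟩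
  have := Nat.add_one_mul_choose_eq m k
  simp only [Nat.add_sub_cancel]
  rw [mul_comm ((k + 1 : ℕ) : ℝ)]
  exact_mod_cast this

theorem aux_count2 {n τ : ℕ} (hτ1 : 1 ≤ τ) {i j : Fin n} (hij : i ≠ j) :
    (n : ℝ) * (n - 1) *
      (((Finset.univ.powersetCard τ).filter (fun C : Finset (Fin n) => i ∈ C ∧ j ∈ C)).card : ℝ)
      = τ * (τ - 1) * n.choose τ := by
  rcases hτ1.eq_or_lt with rfl | h2
  · have : ((Finset.univ.powersetCard 1).filter
        (fun C : Finset (Fin n) => i ∈ C ∧ j ∈ C)) = ∅ := by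
      ext C
      simp only [Finset.mem_filter, Finset.mem_powersetCard_univ, Finset.notMem_empty, iff_false]
      rintro ⟨hC, hi, hj⟩
      exact hij (Finset.card_le_one.1 hC.le i hi j hj)
    rw [this]; simp
  · have := Finset.card_filter_powersetCard_subset {i, j} Finset.univ τ (Finset.subset_univ _)
      (by rw [Finset.card_pair hij]; omega)
    simp only [Finset.insert_subset_iff, Finset.singleton_subset_iff, Finset.card_univ,
      Fintype.card_fin, Finset.card_pair hij] at this
    rw [this]
    obtain ⟨k, rfl⟩ : ∃ k, τ = k + 2 := ⟨τ - 2, by omega⟩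
    obtain ⟨m, rfl⟩ : ∃ m, n = m + 2 := ⟨n - 2, by
      have := i.2; have := j.2; have : i.1 ≠ j.1 := fun h => hij (Fin.ext h); omega⟩
    have h1 : ((m : ℝ) + 1) * m.choose k = (m + 1).choose (k + 1) * (k + 1) := by
      exact_mod_cast Nat.add_one_mul_choose_eq m k
    have h2 : ((m : ℝ) + 2) * (m + 1).choose (k + 1) = (m + 2).choose (k + 2) * (k + 2) := by
      exact_mod_cast Nat.add_one_mul_choose_eq (m + 1) (k + 1)
    simp only [Nat.add_sub_cancel]
    push_cast
    linear_combination ((m : ℝ) + 2) * h1 + (k + 1) * h2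

theorem aux_var {n τ : ℕ} (hn : 2 ≤ n) (hτ1 : 1 ≤ τ) (b : Fin n → E) (hb : ∑ i, b i = 0) :
    (n : ℝ) * (n - 1) * ∑ C ∈ Finset.univ.powersetCard τ, ‖∑ i ∈ C, b i‖ ^ 2
      = τ * (n - τ) * n.choose τ * ∑ i, ‖b i‖ ^ 2 := by
  have e1 : ∀ C : Finset (Fin n), ‖∑ i ∈ C, b i‖ ^ 2
      = ∑ i, ∑ j, if i ∈ C ∧ j ∈ C then ⟪b i, b j⟫ else 0 := by
    intro C
    rw [← real_inner_self_eq_norm_sq, sum_inner]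
    simp_rw [inner_sum, ite_and]
    have e0 : ∀ i, (∑ j, if i ∈ C then (if j ∈ C then ⟪b i, b j⟫ else 0) else 0)
        = if i ∈ C then ∑ j ∈ C, ⟪b i, b j⟫ else 0 := by
      intro i
      split_ifs <;> simp
    simp_rw [e0]
    simp
  have e2 : ∑ C ∈ Finset.univ.powersetCard τ, ‖∑ i ∈ C, b i‖ ^ 2
      = ∑ i, ∑ j, (((Finset.univ.powersetCard τ).filter
          (fun C : Finset (Fin n) => i ∈ C ∧ j ∈ C)).card : ℝ) * ⟪b i, b j⟫ := by
    simp_rw [e1]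
    rw [Finset.sum_comm]
    refine Finset.sum_congr rfl fun i _ => ?_
    rw [Finset.sum_comm]
    refine Finset.sum_congr rfl fun j _ => ?_
    rw [← Finset.sum_filter, Finset.sum_const, nsmul_eq_mul]
  have e3 : ∀ i j, (n : ℝ) * (n - 1) * ((((Finset.univ.powersetCard τ).filter
          (fun C : Finset (Fin n) => i ∈ C ∧ j ∈ C)).card : ℝ) * ⟪b i, b j⟫)
      = τ * (τ - 1) * n.choose τ * ⟪b i, b j⟫ +
        if i = j then τ * (n - τ) * n.choose τ * ‖b i‖ ^ 2 else 0 := by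
    intro i j
    split_ifs with h
    · subst h
      simp only [and_self, real_inner_self_eq_norm_sq]
      have := aux_count1 hτ1 i
      linear_combination ((n : ℝ) - 1) * ‖b i‖ ^ 2 * this
    · rw [← mul_assoc, aux_count2 hτ1 h, add_zero]
  rw [e2]
  simp_rw [Finset.mul_sum, e3, Finset.sum_add_distrib]
  simp [← Finset.mul_sum, ← inner_sum, hb]

theorem aux_center {n : ℕ} (hn : 2 ≤ n) (a : Fin n → E) :
    ∑ i, ‖a i - (n : ℝ)⁻¹ • ∑ j, a j‖ ^ 2 ≤ ∑ i, ‖a i‖ ^ 2 := by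
  have hn0 : (n : ℝ) ≠ 0 := by positivity
  set m := (n : ℝ)⁻¹ • ∑ j, a j with hm
  have hs : ∑ j, a j = (n : ℝ) • m := by rw [hm, smul_inv_smul₀ hn0]
  simp_rw [norm_sub_sq_real]
  rw [Finset.sum_add_distrib, Finset.sum_sub_distrib, ← Finset.mul_sum, ← sum_inner, hs,
    real_inner_smul_left, real_inner_self_eq_norm_sq]
  simp
  nlinarith [mul_nonneg (Nat.cast_nonneg (α := ℝ) n) (sq_nonneg ‖m‖)]

end helpers

/-- Lemma F.3(i) of the paper: bound on the constant ℒ₂ for τ-nice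
sampling (uniform over subsets of cardinality τ) with `θ^i_S = n/τ`. -/
theorem L2_nice_sampling
    {d n : ℕ} (hn : 2 ≤ n) (τ : ℕ) (hτ1 : 1 ≤ τ) (hτn : τ ≤ n)
    (f : Fin n → EuclideanSpace ℝ (Fin d) → ℝ)
    (f' : Fin n → EuclideanSpace ℝ (Fin d) → EuclideanSpace ℝ (Fin d))
    (hgrad : ∀ i x, HasGradientAt (f i) (f' i x) x)
    (L : Fin n → ℝ) (hL0 : ∀ i, 0 ≤ L i)
    (hconv : ∀ i, ConvexOn ℝ Set.univ (f i))
    (hsmooth : ∀ i, LipschitzWith (Real.toNNReal (L i)) (f' i))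
    (fbar : EuclideanSpace ℝ (Fin d) → ℝ)
    (hfbar : ∀ u, fbar u = (n : ℝ)⁻¹ * ∑ i, f i u)
    (fgrad : EuclideanSpace ℝ (Fin d) → EuclideanSpace ℝ (Fin d))
    (hfgrad : ∀ u, fgrad u = (n : ℝ)⁻¹ • ∑ i, f' i u)
    (x y : EuclideanSpace ℝ (Fin d)) :
    ∑ C ∈ Finset.univ.filter (fun C : Finset (Fin n) => C.card = τ),
        ((n.choose τ : ℝ))⁻¹ *
          ‖(n : ℝ)⁻¹ • ∑ i ∈ C, ((n : ℝ) / (τ : ℝ)) • (f' i x - f' i y)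
              - (fgrad x - fgrad y)‖ ^ 2
      ≤ 2 * (((n : ℝ) - (τ : ℝ)) / ((τ : ℝ) * ((n : ℝ) - 1)))
          * (Finset.univ.sup'
              (Finset.univ_nonempty_iff.mpr (Fin.pos_iff_nonempty.mp (by omega))) L)
          * (fbar x - fbar y - ⟪fgrad y, x - y⟫) := by
  have hn0 : (0 : ℝ) < n := by positivity
  have hτ0 : (0 : ℝ) < τ := by exact_mod_cast hτ1
  have hn1 : (0 : ℝ) < (n : ℝ) - 1 := by
    have : (2 : ℝ) ≤ n := by exact_mod_cast hn
    linarith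
  have hnτ : (0 : ℝ) ≤ (n : ℝ) - τ := by
    have : (τ : ℝ) ≤ n := by exact_mod_cast hτn
    linarith
  have hch : (0 : ℝ) < n.choose τ := by exact_mod_cast Nat.choose_pos hτn
  generalize hM : Finset.univ.sup' _ L = M
  have hLM : ∀ i, L i ≤ M := fun i => hM ▸ Finset.le_sup' L (Finset.mem_univ i)
  set a : Fin n → EuclideanSpace ℝ (Fin d) := fun i => f' i x - f' i y with ha
  set m := (n : ℝ)⁻¹ • ∑ j, a j with hm
  have hfm : fgrad x - fgrad y = m := by
    rw [hfgrad, hfgrad, hm, ← smul_sub, ← Finset.sum_sub_distrib]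
  have hsum0 : ∑ i, (a i - m) = 0 := by
    rw [Finset.sum_sub_distrib, hm]
    simp only [Finset.sum_const, Finset.card_univ, Fintype.card_fin]
    rw [← Nat.cast_smul_eq_nsmul ℝ, smul_inv_smul₀ hn0.ne', sub_self]
  have hcoco : ∀ i, ‖a i‖ ^ 2 ≤ 2 * M * (f i x - f i y - ⟪f' i y, x - y⟫) := by
    intro i
    have hs : ∀ u v, ‖f' i u - f' i v‖ ≤ L i * ‖u - v‖ := by
      intro u v
      have := (hsmooth i).norm_sub_le u v
      rwa [Real.coe_toNNReal _ (hL0 i)] at this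
    refine (aux_coco (hgrad i) (hconv i) (hL0 i) hs x y).trans ?_
    have := aux_convex (hgrad i) (hconv i) x y
    exact mul_le_mul_of_nonneg_right (by linarith [hLM i]) (by linarith)
  have hB : ∑ i, (f i x - f i y - ⟪f' i y, x - y⟫) = n * (fbar x - fbar y - ⟪fgrad y, x - y⟫) := by
    rw [hfbar, hfbar, hfgrad, real_inner_smul_left, sum_inner, Finset.sum_sub_distrib,
      Finset.sum_sub_distrib]
    field_simp
  have hA : ∑ i, ‖a i - m‖ ^ 2 ≤ 2 * M * (n * (fbar x - fbar y - ⟪fgrad y, x - y⟫)) := by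
    refine (aux_center hn a).trans ?_
    rw [← hB, Finset.mul_sum]
    exact Finset.sum_le_sum fun i _ => hcoco i
  have hset : Finset.univ.filter (fun C : Finset (Fin n) => C.card = τ)
      = Finset.univ.powersetCard τ := by
    ext C; simp [Finset.mem_powersetCard_univ]
  have hterm : ∀ C ∈ Finset.univ.powersetCard τ,
      ((n.choose τ : ℝ))⁻¹ * ‖(n : ℝ)⁻¹ • ∑ i ∈ C, ((n : ℝ) / (τ : ℝ)) • (f' i x - f' i y)
              - (fgrad x - fgrad y)‖ ^ 2
      = (((n.choose τ : ℝ))⁻¹ * ((τ : ℝ)⁻¹) ^ 2) * ‖∑ i ∈ C, (a i - m)‖ ^ 2 := by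
    intro C hC
    rw [Finset.mem_powersetCard_univ] at hC
    have : (n : ℝ)⁻¹ • ∑ i ∈ C, ((n : ℝ) / (τ : ℝ)) • (f' i x - f' i y) - (fgrad x - fgrad y)
        = (τ : ℝ)⁻¹ • ∑ i ∈ C, (a i - m) := by
      rw [hfm, ← Finset.smul_sum, smul_smul, Finset.sum_sub_distrib (f := a), Finset.sum_const, hC,
        ← Nat.cast_smul_eq_nsmul ℝ, smul_sub, inv_smul_smul₀ hτ0.ne']
      congr 2
      field_simp
    rw [this, norm_smul, mul_pow, Real.norm_of_nonneg (by positivity)]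
    ring
  rw [hset, Finset.sum_congr rfl hterm, ← Finset.mul_sum]
  have hv := aux_var (τ := τ) hn hτ1 (fun i => a i - m) hsum0
  have hv' : ∑ C ∈ Finset.univ.powersetCard τ, ‖∑ i ∈ C, (a i - m)‖ ^ 2
      = τ * (n - τ) * n.choose τ * (∑ i, ‖a i - m‖ ^ 2) / (n * (n - 1)) := by
    rw [eq_div_iff (by positivity), ← hv]; ring
  rw [hv']
  calc _ = ((n : ℝ) - τ) / (τ * n * (n - 1)) * ∑ i, ‖a i - m‖ ^ 2 := by
        have := hn1.ne'
        field_simp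
    _ ≤ ((n : ℝ) - τ) / (τ * n * (n - 1)) *
          (2 * M * (n * (fbar x - fbar y - ⟪fgrad y, x - y⟫))) :=
        mul_le_mul_of_nonneg_left hA (by positivity)
    _ = _ := by
        have := hn1.ne'
        field_simp
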